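/- arXiv:1309.3381 — 2 statements merged into one kernel-verified Lean document; each statement's English description precedes it below -/
import Mathlib

section
/- Let G and G' be finitely generated Abelian groups. If the sets of growth functions with respect to finite symmetric generating sets coincide, i.e. { β_{G,S} : S a finite symmetric generating set of G } = { β_{G',S'} : S' a finite symmetric generating set of G' }, then rk G = rk G' and |tors G| = |tors G'|. -/
/-- `S` is a monoid generating set of the group `G`: every element of `G` is a
product of finitely many elements of `S`. -/
def IsMonGenSet {G : Type*} [Group G] (S : Set G) : Prop := Submonoid.closure S = ⊤

/-- `S` is symmetric: closed under inverses. -/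
def IsSymmSet {G : Type*} [Group G] (S : Set G) : Prop := ∀ s ∈ S, s⁻¹ ∈ S

/-- The word length of `g` with respect to `S`: the least `n` such that `g` is a
product of `n` elements of `S`. -/
noncomputable def wlen {G : Type*} [Group G] (S : Set G) (g : G) : ℕ :=
  sInf {n | ∃ l : List G, (∀ x ∈ l, x ∈ S) ∧ l.length = n ∧ l.prod = g}

/-- The growth function `β_{G,S}`: the cardinality of the ball of radius `r`. -/
noncomputable def growth {G : Type*} [Group G] (S : Set G) (r : ℕ) : ℕ :=
  Set.ncard {g : G | wlen S g ≤ r}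

/-- The spherical growth function `σ_{G,S}`. -/
noncomputable def sph {G : Type*} [Group G] (S : Set G) (r : ℕ) : ℕ :=
  Set.ncard {g : G | wlen S g = r}

/-- The standard symmetric generating set `E_d ∪ (-E_d)` of `ℤ^d`. -/
def stdSymmSet (d : ℕ) : Set (Multiplicative (Fin d → ℤ)) :=
  {x | ∃ i : Fin d, x = Multiplicative.ofAdd (Pi.single i 1) ∨
       x = Multiplicative.ofAdd (-Pi.single i 1)}

/-- The standard symmetric growth function `β_d` of `ℤ^d`. -/
noncomputable def betaStd (d : ℕ) : ℕ → ℕ := growth (stdSymmSet d)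

/-- The standard monoid generating set `E_d ∪ {v_d}` of `ℤ^d`. -/
def stdMonSet (d : ℕ) : Set (Multiplicative (Fin d → ℤ)) :=
  {x | (∃ i : Fin d, x = Multiplicative.ofAdd (Pi.single i 1)) ∨
       x = Multiplicative.ofAdd (fun _ => (-1 : ℤ))}

/-- The standard monoid growth function `β⁺_d` of `ℤ^d`. -/
noncomputable def betaPlus (d : ℕ) : ℕ → ℕ := growth (stdMonSet d)

/-- The rank of a finitely generated abelian group. -/
noncomputable def rk (G : Type*) [CommGroup G] : ℕ := Module.finrank ℤ (Additive G)

section WordLength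

variable {G : Type*} [Group G] {S : Set G}

lemma exists_list_of_isMonGenSet (hS : IsMonGenSet S) (g : G) :
    ∃ l : List G, (∀ x ∈ l, x ∈ S) ∧ l.length = wlen S g ∧ l.prod = g := by
  have hne : {n | ∃ l : List G, (∀ x ∈ l, x ∈ S) ∧ l.length = n ∧ l.prod = g}.Nonempty := by
    have hg : g ∈ Submonoid.closure S := by rw [show Submonoid.closure S = ⊤ from hS]; trivial
    obtain ⟨l, hl, hp⟩ := Submonoid.exists_list_of_mem_closure hg
    exact ⟨l.length, l, hl, rfl, hp⟩
  exact Nat.sInf_mem hne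

lemma wlen_le_length {l : List G} (hl : ∀ x ∈ l, x ∈ S) : wlen S l.prod ≤ l.length :=
  Nat.sInf_le ⟨l, hl, rfl, rfl⟩

lemma wlen_mul_le (hS : IsMonGenSet S) (g h : G) : wlen S (g * h) ≤ wlen S g + wlen S h := by
  obtain ⟨l, hl, hl', rfl⟩ := exists_list_of_isMonGenSet hS g
  obtain ⟨m, hm, hm', rfl⟩ := exists_list_of_isMonGenSet hS h
  rw [← hl', ← hm', ← List.prod_append, ← List.length_append]
  refine wlen_le_length fun x hx => ?_
  rcases List.mem_append.1 hx with hx | hx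
  exacts [hl x hx, hm x hx]

lemma wlen_pow_le {s : G} (hs : s ∈ S) (n : ℕ) : wlen S (s ^ n) ≤ n := by
  have := wlen_le_length (S := S) (l := List.replicate n s)
    fun x hx => (List.eq_of_mem_replicate hx) ▸ hs
  simpa using this

lemma wlen_zpow_le (hsymm : IsSymmSet S) {s : G} (hs : s ∈ S) (n : ℤ) :
    wlen S (s ^ n) ≤ n.natAbs := by
  rcases Int.natAbs_eq n with h | h
  · rw [h, zpow_natCast, Int.natAbs_natCast]
    exact wlen_pow_le hs _
  · rw [h, zpow_neg, zpow_natCast, ← inv_pow, Int.natAbs_neg, Int.natAbs_natCast]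
    exact wlen_pow_le (hsymm s hs) _

lemma finite_wlen_le (hS : IsMonGenSet S) (hfin : S.Finite) (r : ℕ) :
    {g : G | wlen S g ≤ r}.Finite := by
  have : Finite S := hfin
  refine ((List.finite_length_le S r).image fun l => (l.map Subtype.val).prod).subset ?_
  intro g hg
  obtain ⟨l, hl, hl', rfl⟩ := exists_list_of_isMonGenSet hS g
  lift l to List S using hl
  refine ⟨l, ?_, rfl⟩
  rw [List.length_map] at hl'
  exact hl'.trans_le hg

end WordLength

lemma wlen_prod_zpow_le {G : Type*} [CommGroup G] {S : Set G} (hS : IsMonGenSet S)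
    (hsymm : IsSymmSet S) {ι : Type*} (s : Finset ι) {e : ι → G} (he : ∀ i, e i ∈ S)
    (n : ι → ℤ) : wlen S (∏ i ∈ s, e i ^ n i) ≤ ∑ i ∈ s, (n i).natAbs := by
  classical
  induction s using Finset.induction_on with
  | empty => simpa using wlen_le_length (S := S) (l := [])
  | insert a s ha ih =>
    rw [Finset.prod_insert ha, Finset.sum_insert ha]
    exact (wlen_mul_le hS _ _).trans (add_le_add (wlen_zpow_le hsymm (he a) _) ih)

section LatticeBall

/-- The ball of radius `r` in `ℤ^d` for the `ℓ¹` norm. -/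
def latticeBall (d r : ℕ) : Set (Fin d → ℤ) := {n | ∑ i, (n i).natAbs ≤ r}

lemma latticeBall_subset_Icc (d r : ℕ) :
    latticeBall d r ⊆ (Finset.Icc (fun _ => -(r : ℤ)) (fun _ => (r : ℤ)) : Finset (Fin d → ℤ)) := by
  intro n hn
  have h : ∀ i, (n i).natAbs ≤ r := fun i =>
    (Finset.single_le_sum (f := fun i => (n i).natAbs) (fun _ _ => Nat.zero_le _)
      (Finset.mem_univ i)).trans hn
  simp only [Finset.coe_Icc, Set.mem_Icc, Pi.le_def]
  exact ⟨fun i => by have := h i; omega, fun i => by have := h i; omega⟩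

lemma finite_latticeBall (d r : ℕ) : (latticeBall d r).Finite :=
  (Finset.finite_toSet _).subset (latticeBall_subset_Icc d r)

lemma ncard_latticeBall_le (d r : ℕ) : (latticeBall d r).ncard ≤ (2 * r + 1) ^ d := by
  refine (Set.ncard_le_ncard (latticeBall_subset_Icc d r) (Finset.finite_toSet _)).trans ?_
  rw [Set.ncard_coe_finset, Pi.card_Icc]
  simp only [Int.card_Icc, Finset.prod_const, Finset.card_univ, Fintype.card_fin]
  exact Nat.pow_le_pow_left (by omega) d

lemma pow_le_ncard_latticeBall (d k : ℕ) : (k + 1) ^ d ≤ (latticeBall d (d * k)).ncard := by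
  have := Set.ncard_le_ncard_of_injOn (s := (Set.univ : Set (Fin d → Fin (k + 1))))
    (t := latticeBall d (d * k)) (fun n i => ((n i : ℕ) : ℤ))
    (fun n _ => by
      have : ∑ i, (n i : ℕ) ≤ ∑ _i : Fin d, k := Finset.sum_le_sum fun i _ => by omega
      simpa [latticeBall] using this)
    (fun n _ m _ h => by
      funext i
      have := congrFun h i
      simp only [Nat.cast_inj] at this
      exact Fin.ext this) (finite_latticeBall _ _)
  simpa [Set.ncard_univ] using this

lemma add_mem_latticeBall {d r s : ℕ} {m n : Fin d → ℤ} (hm : m ∈ latticeBall d r)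
    (hn : n ∈ latticeBall d s) : m + n ∈ latticeBall d (r + s) := by
  refine le_trans ?_ (Nat.add_le_add hm hn)
  rw [← Finset.sum_add_distrib]
  exact Finset.sum_le_sum fun i _ => Int.natAbs_add_le _ _

lemma neg_mem_latticeBall {d r : ℕ} {n : Fin d → ℤ} (hn : n ∈ latticeBall d r) :
    -n ∈ latticeBall d r := by
  simpa [latticeBall] using hn

lemma zero_mem_latticeBall (d r : ℕ) : 0 ∈ latticeBall d r := by simp [latticeBall]

lemma latticeBall_mono (d : ℕ) {r s : ℕ} (h : r ≤ s) : latticeBall d r ⊆ latticeBall d s :=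
  fun _ hn => le_trans hn h

lemma ncard_latticeBall_pos (d r : ℕ) : 0 < (latticeBall d r).ncard :=
  (Set.ncard_pos (finite_latticeBall d r)).2 ⟨0, zero_mem_latticeBall d r⟩

lemma le_of_mul_ncard_latticeBall_le {d d' t t' c : ℕ} (ht' : 0 < t')
    (h : ∀ r, t' * (latticeBall d' r).ncard ≤ t * (latticeBall d (r + c)).ncard) : d' ≤ d := by
  by_contra! hlt
  set C := 2 * d' + 2 * c + 1
  have key : ∀ k : ℕ, k + 1 ≤ t * C ^ d := by
    intro k
    have h1 : (k + 1) ^ (d + 1) ≤ t * C ^ d * (k + 1) ^ d :=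
      calc (k + 1) ^ (d + 1) ≤ (k + 1) ^ d' := Nat.pow_le_pow_right (by omega) hlt
        _ ≤ (latticeBall d' (d' * k)).ncard := pow_le_ncard_latticeBall d' k
        _ ≤ t' * (latticeBall d' (d' * k)).ncard := Nat.le_mul_of_pos_left _ ht'
        _ ≤ t * (latticeBall d (d' * k + c)).ncard := h _
        _ ≤ t * (2 * (d' * k + c) + 1) ^ d := by gcongr; exact ncard_latticeBall_le _ _
        _ ≤ t * (C * (k + 1)) ^ d := by
          gcongr
          simp only [C]
          nlinarith [Nat.zero_le (c * k)]
        _ = t * C ^ d * (k + 1) ^ d := by rw [mul_pow, mul_assoc]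
    rw [pow_succ, mul_comm] at h1
    exact Nat.le_of_mul_le_mul_right h1 (by positivity)
  have := key (t * C ^ d)
  omega

lemma le_of_mul_ncard_latticeBall_le_same {d t t' c : ℕ} (ht : 0 < t)
    (h : ∀ r, t' * (latticeBall d r).ncard ≤ t * (latticeBall d (r + c)).ncard) : t' ≤ t := by
  by_contra! hlt
  have hiter : ∀ k : ℕ, t' ^ k ≤ t ^ k * (latticeBall d (c * k)).ncard := by
    intro k
    induction k with
    | zero => simpa [Nat.one_le_iff_ne_zero] using (ncard_latticeBall_pos d 0).ne'
    | succ k ih =>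
      calc t' ^ (k + 1) = t' * t' ^ k := by ring
        _ ≤ t' * (t ^ k * (latticeBall d (c * k)).ncard) := by gcongr
        _ = t ^ k * (t' * (latticeBall d (c * k)).ncard) := by ring
        _ ≤ t ^ k * (t * (latticeBall d (c * k + c)).ncard) := Nat.mul_le_mul_left _ (h _)
        _ = t ^ (k + 1) * (latticeBall d (c * (k + 1))).ncard := by rw [mul_add, mul_one]; ring
  have htR : (0 : ℝ) < t := by exact_mod_cast ht
  have hx : (1 : ℝ) < t' / t := by rw [one_lt_div htR]; exact_mod_cast hlt
  have hlim := (tendsto_pow_const_div_const_pow_of_one_lt d hx).const_mul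
    (((2 * c + 1) ^ d : ℕ) : ℝ)
  rw [mul_zero] at hlim
  obtain ⟨k, hk, hk1⟩ := ((hlim.eventually (gt_mem_nhds one_pos)).and
    (Filter.eventually_ge_atTop 1)).exists
  have hle : t' ^ k ≤ t ^ k * ((2 * c + 1) ^ d * k ^ d) := by
    refine (hiter k).trans (Nat.mul_le_mul_left _ ((ncard_latticeBall_le _ _).trans ?_))
    rw [← mul_pow]
    exact Nat.pow_le_pow_left (by nlinarith) d
  have hleR : (t' : ℝ) ^ k ≤ t ^ k * (((2 * c + 1) ^ d : ℕ) * k ^ d) := by exact_mod_cast hle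
  rw [← mul_div_assoc, div_lt_one (by positivity), div_pow, lt_div_iff₀ (by positivity)] at hk
  linarith

end LatticeBall

section FinitelyGenerated

variable {G : Type*} [CommGroup G]

lemma finite_torsion_of_fg (hG : Group.FG G) : (CommGroup.torsion G : Set G).Finite := by
  have : Module.Finite ℤ (Additive G) :=
    Module.Finite.iff_addGroup_fg.2 (GroupFG.iff_add_fg.1 hG)
  have hfin : Finite (Submodule.torsion ℤ (Additive G)) :=
    Module.finite_of_fg_torsion _ (Submodule.torsion_isTorsion)
  refine ((Set.toFinite (Submodule.torsion ℤ (Additive G) : Set (Additive G))).image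
    Additive.toMul).subset fun g hg => ⟨Additive.ofMul g, ?_, rfl⟩
  change Additive.ofMul g ∈ (Submodule.torsion ℤ (Additive G)).toAddSubgroup
  rw [Submodule.torsion_int]
  exact isOfFinAddOrder_ofMul_iff.2 hg

lemma exists_prod_zpow_mul_torsion (hG : Group.FG G) :
    ∃ e : Fin (rk G) → G, ∀ g, ∃ n : Fin (rk G) → ℤ, ∃ t ∈ CommGroup.torsion G,
      g = (∏ i, e i ^ n i) * t := by
  have : Module.Finite ℤ (Additive G) :=
    Module.Finite.iff_addGroup_fg.2 (GroupFG.iff_add_fg.1 hG)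
  let T := Submodule.torsion ℤ (Additive G)
  have hrk : Module.finrank ℤ (Additive G ⧸ T) = rk G :=
    finrank_quotient_eq_of_le_torsion le_rfl
  let b := Module.finBasisOfFinrankEq ℤ (Additive G ⧸ T) hrk
  choose e he using fun i => T.mkQ_surjective (b i)
  refine ⟨fun i => (e i).toMul, fun g => ?_⟩
  let n : Fin (rk G) → ℤ := fun i => b.repr (T.mkQ (Additive.ofMul g)) i
  refine ⟨n, (∏ i, (e i).toMul ^ n i)⁻¹ * g, ?_, by simp⟩
  have hmem : Additive.ofMul g - ∑ i, n i • e i ∈ T := by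
    rw [← T.ker_mkQ, LinearMap.mem_ker, map_sub, map_sum, sub_eq_zero]
    simp only [map_smul, he]
    exact (b.sum_repr _).symm
  change _ ∈ (Submodule.torsion ℤ (Additive G)).toAddSubgroup at hmem
  rw [Submodule.torsion_int] at hmem
  have := isOfFinAddOrder_ofMul_iff.1 (show IsOfFinAddOrder (Additive.ofMul
    ((∏ i, (e i).toMul ^ n i)⁻¹ * g)) by
      convert (show IsOfFinAddOrder _ from hmem) using 1
      simp [sub_eq_neg_add])
  exact this

lemma exists_independent_of_isMonGenSet {S : Set G} (hS : IsMonGenSet S) (hfin : S.Finite) :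
    ∃ e : Fin (rk G) → G, (∀ i, e i ∈ S) ∧
      ∀ n : Fin (rk G) → ℤ, IsOfFinOrder (∏ i, e i ^ n i) → n = 0 := by
  have : Finite S := hfin
  obtain ⟨s, hs, hmax⟩ := exists_maximal_linearIndepOn ℤ (fun x : S => Additive.ofMul (x : G))
  set v : S → Additive G := fun x => Additive.ofMul (x : G)
  set N : Submodule ℤ (Additive G) := Submodule.span ℤ (v '' s) with hN
  have htors : ∀ g : G, ∃ a : ℤ, a ≠ 0 ∧ a • Additive.ofMul g ∈ N := by
    intro g
    have hg : g ∈ Submonoid.closure S := by rw [show Submonoid.closure S = ⊤ from hS]; trivial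
    induction hg using Submonoid.closure_induction with
    | mem x hx =>
      by_cases hxs : (⟨x, hx⟩ : S) ∈ s
      · exact ⟨1, one_ne_zero, by
          rw [one_smul]; exact Submodule.subset_span ⟨⟨x, hx⟩, hxs, rfl⟩⟩
      · exact hmax ⟨x, hx⟩ hxs
    | one => exact ⟨1, one_ne_zero, by simp⟩
    | mul x y _ _ hx hy =>
      obtain ⟨a, ha, hax⟩ := hx
      obtain ⟨b, hb, hby⟩ := hy
      refine ⟨a * b, mul_ne_zero ha hb, ?_⟩
      rw [ofMul_mul, smul_add]
      refine N.add_mem ?_ ?_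
      · rw [mul_comm, mul_smul]; exact N.smul_mem _ hax
      · rw [mul_smul]; exact N.smul_mem _ hby
  have hquot : Module.rank ℤ (Additive G ⧸ N) = 0 := by
    rw [rank_eq_zero_iff]
    intro x
    obtain ⟨y, rfl⟩ := N.mkQ_surjective x
    obtain ⟨a, ha, hay⟩ := htors y.toMul
    exact ⟨a, ha, by rw [← map_smul, ← LinearMap.mem_ker, N.ker_mkQ]; exact hay⟩
  have hrank : Module.rank ℤ N = Module.rank ℤ (Additive G) := by
    rw [← rank_quotient_add_rank_of_isDomain N, hquot, zero_add]
  have : Fintype s := Fintype.ofFinite s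
  have hcard : Fintype.card s = rk G := by
    have h1 : Module.finrank ℤ N = Fintype.card s := by
      have h2 := finrank_span_eq_card (R := ℤ) (b := fun x : s => v x) hs
      rw [hN, Set.image_eq_range]
      exact h2
    rw [← h1, rk, Module.finrank, Module.finrank, hrank]
  let f : Fin (rk G) ≃ s := (Fintype.equivFinOfCardEq hcard).symm
  have hind : LinearIndependent ℤ fun i => v (f i) :=
    LinearIndependent.comp (v := fun x : s => v x) hs f f.injective
  refine ⟨fun i => (f i : S), fun i => (f i : S).2, fun n hn => ?_⟩
  obtain ⟨m, hm, hm'⟩ := isOfFinOrder_iff_pow_eq_one.1 hn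
  have hsum : ∑ i, ((m : ℤ) * n i) • v (f i) = 0 := by
    have := congrArg Additive.ofMul hm'
    simp only [ofMul_pow, ofMul_prod, ofMul_zpow, ofMul_one] at this
    simpa only [mul_smul, natCast_zsmul, ← Finset.smul_sum] using this
  funext i
  have := Fintype.linearIndependent_iff.1 hind _ hsum i
  have hm0 : (m : ℤ) ≠ 0 := by omega
  exact (mul_eq_zero.1 this).resolve_left hm0

lemma exists_growth_le_card_torsion_mul (hG : Group.FG G) :
    ∃ S : Set G, S.Finite ∧ IsSymmSet S ∧ IsMonGenSet S ∧
      ∀ r, growth S r ≤ Nat.card (CommGroup.torsion G) * (latticeBall (rk G) r).ncard := by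
  obtain ⟨e, he⟩ := exists_prod_zpow_mul_torsion hG
  let φ : (Fin (rk G) → ℤ) × G → G := fun p => (∏ i, e i ^ p.1 i) * p.2
  let B : ℕ → Set G := fun r => φ '' (latticeBall (rk G) r ×ˢ (CommGroup.torsion G : Set G))
  have hBmul : ∀ {r s g h}, g ∈ B r → h ∈ B s → g * h ∈ B (r + s) := by
    rintro r s _ _ ⟨⟨m, t⟩, ⟨hm, ht⟩, rfl⟩ ⟨⟨n, u⟩, ⟨hn, hu⟩, rfl⟩
    refine ⟨⟨m + n, t * u⟩, ⟨add_mem_latticeBall hm hn, mul_mem ht hu⟩, ?_⟩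
    simp only [φ, Pi.add_apply, zpow_add, Finset.prod_mul_distrib]
    exact mul_mul_mul_comm _ _ _ _
  have hBfin : ∀ r, (B r).Finite := fun r =>
    ((finite_latticeBall _ _).prod (finite_torsion_of_fg hG)).image _
  have hBone : ∀ r, (1 : G) ∈ B r := fun r =>
    ⟨⟨0, 1⟩, ⟨zero_mem_latticeBall _ _, one_mem _⟩, by simp [φ]⟩
  have hBsymm : IsSymmSet (B 1) := by
    rintro _ ⟨⟨m, t⟩, ⟨hm, ht⟩, rfl⟩
    refine ⟨⟨-m, t⁻¹⟩, ⟨neg_mem_latticeBall hm, inv_mem ht⟩, ?_⟩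
    simp [φ, mul_comm]
  have heB : ∀ i, e i ∈ B 1 := by
    intro i
    refine ⟨⟨Pi.single i 1, 1⟩, ⟨?_, one_mem _⟩, ?_⟩
    · simp [latticeBall, Pi.single_apply, apply_ite Int.natAbs]
    · simp [φ, Pi.single_apply]
  have hBgen : IsMonGenSet (B 1) := by
    refine (Submonoid.eq_top_iff' _).2 fun g => ?_
    obtain ⟨n, t, ht, rfl⟩ := he g
    refine mul_mem (prod_mem fun i _ => ?_) (Submonoid.subset_closure
      ⟨⟨0, t⟩, ⟨zero_mem_latticeBall _ _, ht⟩, by simp [φ]⟩)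
    rcases Int.natAbs_eq (n i) with h | h
    · rw [h, zpow_natCast]
      exact pow_mem (Submonoid.subset_closure (heB i)) _
    · rw [h, zpow_neg, zpow_natCast, ← inv_pow]
      exact pow_mem (Submonoid.subset_closure (hBsymm _ (heB i))) _
  have hprod : ∀ l : List G, (∀ x ∈ l, x ∈ B 1) → l.prod ∈ B l.length := by
    intro l
    induction l with
    | nil => exact fun _ => hBone 0
    | cons a l ih =>
      intro hl
      rw [List.prod_cons, List.length_cons, add_comm]
      exact hBmul (hl a (by simp)) (ih fun x hx => hl x (by simp [hx]))
  refine ⟨B 1, hBfin 1, hBsymm, hBgen, fun r => ?_⟩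
  have hsub : {g : G | wlen (B 1) g ≤ r} ⊆ B r := by
    intro g hg
    obtain ⟨l, hl, hl', rfl⟩ := exists_list_of_isMonGenSet hBgen g
    exact Set.image_mono (Set.prod_mono_left (latticeBall_mono _ (hl'.trans_le hg)))
      (hprod l hl)
  calc growth (B 1) r ≤ (B r).ncard := Set.ncard_le_ncard hsub (hBfin r)
    _ ≤ (latticeBall (rk G) r ×ˢ (CommGroup.torsion G : Set G)).ncard :=
      Set.ncard_image_le ((finite_latticeBall _ _).prod (finite_torsion_of_fg hG))
    _ = _ := by rw [Set.ncard_prod, mul_comm]; rfl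

lemma exists_card_torsion_mul_le_growth (hG : Group.FG G) {S : Set G} (hfin : S.Finite)
    (hsymm : IsSymmSet S) (hS : IsMonGenSet S) :
    ∃ c, ∀ r, Nat.card (CommGroup.torsion G) * (latticeBall (rk G) r).ncard
      ≤ growth S (r + c) := by
  obtain ⟨e, he, hind⟩ := exists_independent_of_isMonGenSet hS hfin
  obtain ⟨c, hc⟩ := ((finite_torsion_of_fg hG).image (wlen S)).bddAbove
  refine ⟨c, fun r => ?_⟩
  have hinj : Set.InjOn (fun p : (Fin (rk G) → ℤ) × G => (∏ i, e i ^ p.1 i) * p.2)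
      (latticeBall (rk G) r ×ˢ (CommGroup.torsion G : Set G)) := by
    rintro ⟨m, t⟩ ⟨_, ht⟩ ⟨n, u⟩ ⟨_, hu⟩ h
    have h' : (∏ i, e i ^ m i) * t = (∏ i, e i ^ n i) * u := h
    have hmn : m - n = 0 := by
      refine hind _ ?_
      have : ∏ i, e i ^ (m - n) i = u * t⁻¹ := by
        simp only [Pi.sub_apply, zpow_sub, Finset.prod_mul_distrib, Finset.prod_inv_distrib]
        rw [mul_inv_eq_iff_eq_mul, mul_right_comm, eq_mul_inv_iff_mul_eq, h', mul_comm]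
      rw [this]
      exact (CommGroup.torsion G).mul_mem hu ((CommGroup.torsion G).inv_mem ht)
    obtain rfl := sub_eq_zero.1 hmn
    rw [mul_left_cancel h']
  have := Set.ncard_le_ncard_of_injOn (t := {g : G | wlen S g ≤ r + c}) _
    (fun p hp => (wlen_mul_le hS _ _).trans (add_le_add
      ((wlen_prod_zpow_le hS hsymm Finset.univ he p.1).trans hp.1)
      (hc ⟨p.2, hp.2, rfl⟩))) hinj (finite_wlen_le hS hfin _)
  rw [Set.ncard_prod, mul_comm] at this
  exact this

lemma card_torsion_pos (hG : Group.FG G) : 0 < Nat.card (CommGroup.torsion G) :=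
  have : Finite (CommGroup.torsion G) := finite_torsion_of_fg hG
  Nat.card_pos

lemma exists_card_torsion_mul_le_of_symmetric_growth_sets_subset {G' : Type*} [CommGroup G']
    (hG : Group.FG G) (hG' : Group.FG G')
    (h : {f : ℕ → ℕ | ∃ S : Set G, S.Finite ∧ IsSymmSet S ∧ IsMonGenSet S ∧ growth S = f}
      ⊆ {f : ℕ → ℕ | ∃ S : Set G', S.Finite ∧ IsSymmSet S ∧ IsMonGenSet S ∧ growth S = f}) :
    ∃ c, ∀ r, Nat.card (CommGroup.torsion G') * (latticeBall (rk G') r).ncard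
      ≤ Nat.card (CommGroup.torsion G) * (latticeBall (rk G) (r + c)).ncard := by
  obtain ⟨S, hfin, hsymm, hS, hle⟩ := exists_growth_le_card_torsion_mul hG
  obtain ⟨S', hfin', hsymm', hS', heq⟩ := h ⟨S, hfin, hsymm, hS, rfl⟩
  obtain ⟨c, hc⟩ := exists_card_torsion_mul_le_growth hG' hfin' hsymm' hS'
  exact ⟨c, fun r => (hc r).trans (heq ▸ hle (r + c))⟩

end FinitelyGenerated

/-- If two finitely generated Abelian groups have the same set of growth functions
with respect to finite symmetric generating sets, then they have the same rank and
torsion parts of the same size. -/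
theorem rank_and_torsion_card_eq_of_symmetric_growth_sets_eq
    (G G' : Type*) [CommGroup G] [CommGroup G'] (hG : Group.FG G) (hG' : Group.FG G')
    (h : {f : ℕ → ℕ | ∃ S : Set G, S.Finite ∧ IsSymmSet S ∧ IsMonGenSet S ∧ growth S = f}
       = {f : ℕ → ℕ | ∃ S' : Set G', S'.Finite ∧ IsSymmSet S' ∧ IsMonGenSet S' ∧ growth S' = f}) :
    rk G = rk G' ∧ Nat.card (CommGroup.torsion G) = Nat.card (CommGroup.torsion G') := by
  obtain ⟨c, hc⟩ := exists_card_torsion_mul_le_of_symmetric_growth_sets_subset hG hG' h.subset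
  obtain ⟨c', hc'⟩ := exists_card_torsion_mul_le_of_symmetric_growth_sets_subset hG' hG h.superset
  have hrk : rk G = rk G' := le_antisymm
    (le_of_mul_ncard_latticeBall_le (card_torsion_pos hG) hc')
    (le_of_mul_ncard_latticeBall_le (card_torsion_pos hG') hc)
  rw [hrk] at hc hc'
  exact ⟨hrk, le_antisymm
    (le_of_mul_ncard_latticeBall_le_same (card_torsion_pos hG') hc')
    (le_of_mul_ncard_latticeBall_le_same (card_torsion_pos hG) hc)⟩
end

section
/- Let d ∈ ℕ with d > 0, let F be a finite group, let G = ℤ^d × F, and let S be a finite monoid generating set of G. Then for every R ∈ ℕ, limsup_{r → ∞} β_{G,S}(r − R) / β_{G,S}(r) = 1, where the quotient is taken in the real numbers and r − R denotes truncated subtraction in ℕ. -/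
open Filter Topology in
/-- A positive monotone sequence of at most polynomial growth satisfies
`limsup f (r - R) / f r = 1`. -/
theorem limsup_shift_div_eq_one_of_le_pow (f : ℕ → ℕ) (hmono : Monotone f) (hpos : 0 < f 0)
    (C A d : ℕ) (hf : ∀ r, f r ≤ (A * r + 1) ^ d * C) (R : ℕ) :
    limsup (fun r : ℕ => (f (r - R) : ℝ) / (f r : ℝ)) atTop = 1 := by
  have hpos' (r : ℕ) : (0 : ℝ) < f r := by exact_mod_cast hpos.trans_le (hmono r.zero_le)
  have hle (r : ℕ) : (f (r - R) : ℝ) / (f r : ℝ) ≤ 1 := by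
    rw [div_le_one (hpos' r)]
    exact_mod_cast hmono (Nat.sub_le r R)
  have hnonneg (r : ℕ) : (0 : ℝ) ≤ (f (r - R) : ℝ) / (f r : ℝ) := by positivity
  have hbdd : IsBoundedUnder (· ≤ ·) atTop (fun r : ℕ => (f (r - R) : ℝ) / (f r : ℝ)) :=
    isBoundedUnder_of ⟨1, hle⟩
  have hcobdd : IsCoboundedUnder (· ≤ ·) atTop (fun r : ℕ => (f (r - R) : ℝ) / (f r : ℝ)) :=
    (isBoundedUnder_of (r := (· ≥ ·)) ⟨0, hnonneg⟩).isCoboundedUnder_le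
  refine le_antisymm (limsup_le_of_le hcobdd (Eventually.of_forall hle)) ?_
  by_contra! hlt
  obtain ⟨c, hc, hc1⟩ := exists_between hlt
  obtain ⟨r₀, hr₀⟩ := eventually_atTop.1 (eventually_lt_of_limsup_lt hc hbdd)
  have hc0 : 0 < c := (hnonneg r₀).trans_lt (hr₀ r₀ le_rfl)
  have hexp (k : ℕ) : (f r₀ : ℝ) ≤ c ^ k * f (r₀ + k * R) := by
    induction k with
    | zero => simp
    | succ k ih =>
      have h := hr₀ (r₀ + (k + 1) * R) (by omega)
      rw [div_lt_iff₀ (hpos' _), show r₀ + (k + 1) * R - R = r₀ + k * R by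
        rw [add_mul]; omega] at h
      calc (f r₀ : ℝ) ≤ c ^ k * f (r₀ + k * R) := ih
        _ ≤ c ^ k * (c * f (r₀ + (k + 1) * R)) := by gcongr
        _ = _ := by rw [pow_succ, mul_assoc]
  set B : ℝ := A * r₀ + A * R + 1 with hB
  have hlim : Tendsto (fun k : ℕ => B ^ d * C * ((k : ℝ) ^ d * c ^ k)) atTop (𝓝 0) := by
    simpa using (tendsto_pow_const_mul_const_pow_of_abs_lt_one d
      (by rwa [abs_of_pos hc0] : |c| < 1)).const_mul (B ^ d * C)
  obtain ⟨k, hk, hk1⟩ := ((hlim.eventually_lt_const (hpos' r₀)).and (eventually_ge_atTop 1)).exists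
  have hk1' : (1 : ℝ) ≤ k := by exact_mod_cast hk1
  have hlin : (A : ℝ) * (r₀ + k * R) + 1 ≤ B * k := by
    have : (0 : ℝ) ≤ A * r₀ * (k - 1) := mul_nonneg (by positivity) (by linarith)
    rw [hB]
    linarith
  have hpoly : (f (r₀ + k * R) : ℝ) ≤ (A * (r₀ + k * R) + 1) ^ d * C := by
    exact_mod_cast hf (r₀ + k * R)
  refine hk.not_ge ?_
  calc (f r₀ : ℝ) ≤ c ^ k * f (r₀ + k * R) := hexp k
    _ ≤ c ^ k * ((A * (r₀ + k * R) + 1) ^ d * C) := by gcongr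
    _ ≤ c ^ k * ((B * k) ^ d * C) := by gcongr
    _ = B ^ d * C * (k ^ d * c ^ k) := by rw [mul_pow]; ring

theorem IsMonGenSet.exists_list_length_eq_wlen {G : Type*} [Group G] {S : Set G}
    (hS : IsMonGenSet S) (g : G) :
    ∃ l : List G, (∀ x ∈ l, x ∈ S) ∧ l.length = wlen S g ∧ l.prod = g := by
  obtain ⟨l, hl, hg⟩ := Submonoid.exists_list_of_mem_closure
    (show g ∈ Submonoid.closure S from hS ▸ Submonoid.mem_top g)
  exact Nat.sInf_mem (s := {n | ∃ l : List G, (∀ x ∈ l, x ∈ S) ∧ l.length = n ∧ l.prod = g})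
    ⟨_, l, hl, rfl, hg⟩

theorem wlen_one {G : Type*} [Group G] (S : Set G) : wlen S 1 = 0 :=
  Nat.sInf_eq_zero.2 (Or.inl ⟨[], by simp⟩)

/-- If the elements of `S` have coordinates bounded by `M`, a product of `n` elements of `S`
has coordinates bounded by `M * n`. -/
theorem natAbs_list_prod_le {d : ℕ} {F : Type*} [Group F]
    {S : Set (Multiplicative (Fin d → ℤ) × F)} {M : ℕ}
    (hM : ∀ s ∈ S, ∀ i, (s.1.toAdd i).natAbs ≤ M)
    (l : List (Multiplicative (Fin d → ℤ) × F)) (hl : ∀ x ∈ l, x ∈ S) (i : Fin d) :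
    (l.prod.1.toAdd i).natAbs ≤ M * l.length := by
  induction l with
  | nil => simp
  | cons a l ih =>
    have h1 := hM a (hl a (by simp)) i
    have h2 := ih fun x hx => hl x (by simp [hx])
    simp only [List.prod_cons, Prod.fst_mul, toAdd_mul, Pi.add_apply, List.length_cons]
    calc _ ≤ _ := Int.natAbs_add_le _ _
      _ ≤ M + M * l.length := by gcongr
      _ = M * (l.length + 1) := by rw [mul_add_one, add_comm]

theorem exists_natAbs_le_of_finite {d : ℕ} {F : Type*}
    {S : Set (Multiplicative (Fin d → ℤ) × F)} (hS : S.Finite) :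
    ∃ M : ℕ, ∀ s ∈ S, ∀ i, (s.1.toAdd i).natAbs ≤ M := by
  obtain ⟨M, hM⟩ := (hS.image fun s => ∑ i, (s.1.toAdd i).natAbs).bddAbove
  exact ⟨M, fun s hs i => (Finset.single_le_sum (f := fun i => (s.1.toAdd i).natAbs)
    (fun _ _ => Nat.zero_le _) (Finset.mem_univ i)).trans (hM ⟨s, hs, rfl⟩)⟩

/-- The elements of `ℤ^d × F` whose coordinates have absolute value at most `N`. -/
def coordBox (d : ℕ) (F : Type*) (N : ℕ) : Set (Multiplicative (Fin d → ℤ) × F) :=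
  (Multiplicative.toAdd ⁻¹' Set.Icc (fun _ => -(N : ℤ)) (fun _ => (N : ℤ))) ×ˢ Set.univ

theorem finite_coordBox (d : ℕ) (F : Type*) [Finite F] (N : ℕ) : (coordBox d F N).Finite :=
  ((Set.finite_Icc _ _).preimage Multiplicative.toAdd.injective.injOn).prod Set.finite_univ

theorem ncard_coordBox (d : ℕ) (F : Type*) [Finite F] (N : ℕ) :
    (coordBox d F N).ncard = (2 * N + 1) ^ d * Nat.card F := by
  rw [coordBox, Set.ncard_prod, Set.ncard_univ, Set.ncard_preimage_of_injective_subset_range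
    Multiplicative.toAdd.injective (by simp [Multiplicative.toAdd.surjective.range_eq]),
    ← Finset.coe_Icc, Set.ncard_coe_finset, Pi.card_Icc]
  simp only [Int.card_Icc, Finset.prod_const, Finset.card_univ, Fintype.card_fin]
  congr 2
  omega

theorem ball_subset_coordBox {d : ℕ} {F : Type*} [Group F]
    {S : Set (Multiplicative (Fin d → ℤ) × F)} (hgen : IsMonGenSet S) {M : ℕ}
    (hM : ∀ s ∈ S, ∀ i, (s.1.toAdd i).natAbs ≤ M) (r : ℕ) :
    {g | wlen S g ≤ r} ⊆ coordBox d F (M * r) := by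
  intro g hg
  obtain ⟨l, hl, hlen, rfl⟩ := hgen.exists_list_length_eq_wlen g
  have h (i : Fin d) : (l.prod.1.toAdd i).natAbs ≤ M * r :=
    (natAbs_list_prod_le hM l hl i).trans (Nat.mul_le_mul_left M (hlen.trans_le hg))
  refine ⟨⟨fun i => ?_, fun i => ?_⟩, Set.mem_univ _⟩ <;>
  · have := h i
    dsimp only
    omega

/-- For `G = ℤ^d × F` with `F` finite and `d > 0`, and a finite monoid generating set
`S`, `limsup_{r → ∞} β_{G,S}(r - R) / β_{G,S}(r) = 1` for every `R ∈ ℕ`. -/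
theorem limsup_growth_shift_div_growth_eq_one (d : ℕ) (hd : 0 < d)
    (F : Type*) [Group F] [Finite F]
    (S : Set (Multiplicative (Fin d → ℤ) × F)) (hS : S.Finite) (hgen : IsMonGenSet S)
    (R : ℕ) :
    Filter.limsup (fun r : ℕ => (growth S (r - R) : ℝ) / (growth S r : ℝ)) Filter.atTop = 1 := by
  obtain ⟨M, hM⟩ := exists_natAbs_le_of_finite hS
  have hfin (r : ℕ) : {g | wlen S g ≤ r}.Finite :=
    (finite_coordBox d F (M * r)).subset (ball_subset_coordBox hgen hM r)
  refine limsup_shift_div_eq_one_of_le_pow (growth S) (fun a b hab => ?_) ?_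
    (Nat.card F) (2 * M) d (fun r => ?_) R
  · exact Set.ncard_le_ncard (fun g (hg : wlen S g ≤ a) => hg.trans hab) (hfin b)
  · exact (Set.ncard_pos (hfin 0)).2 ⟨1, (wlen_one S).le⟩
  · rw [mul_assoc, ← ncard_coordBox]
    exact Set.ncard_le_ncard (ball_subset_coordBox hgen hM r) (finite_coordBox d F _)
end
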